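/- Let I be a nonempty finite set of positive integers with m = max(I) such that m − 1 ∉ I. Then there exists t_0 ∈ ℕ such that for every integer t > t_0, all complex roots of the descent polynomial d(I^t,·) are real and contained in the interval [−1, m+t], where I^t = I ∪ {m+1, …, m+t}. -/

import Mathlib

/-- The descent set of a permutation of `{1,…,n}` (modeled on `Fin n`), as a set of
1-indexed positions `i ∈ {1, …, n-1}` with `π_i > π_{i+1}`. -/
noncomputable def descSet (n : ℕ) (π : Equiv.Perm (Fin n)) : Finset ℕ :=
  @Finset.filter _
    (fun i => ∃ (h1 : i - 1 < n) (h2 : i < n), π ⟨i, h2⟩ < π ⟨i - 1, h1⟩)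
    (Classical.decPred _) (Finset.Ioo 0 n)

/-- `dCount I n` is the number of permutations of `{1,…,n}` with descent set `I`. -/
noncomputable def dCount (I : Finset ℕ) (n : ℕ) : ℕ :=
  Nat.card {π : Equiv.Perm (Fin n) // descSet n π = I}

/-- `mI I = max (I ∪ {0})`. -/
def mI (I : Finset ℕ) : ℕ := I.sup id

/-- `Iext I t = I^t = I ∪ {m+1, m+2, …, m+t}` where `m = max(I ∪ {0})`. -/
def Iext (I : Finset ℕ) (t : ℕ) : Finset ℕ := I ∪ Finset.Icc (mI I + 1) (mI I + t)


theorem mem_descSet' {n : ℕ} {π : Equiv.Perm (Fin n)} {i : ℕ} :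
    i ∈ descSet n π ↔ 0 < i ∧ ∃ h : i < n, π ⟨i, h⟩ < π ⟨i - 1, by omega⟩ := by
  unfold descSet
  simp only [Finset.mem_filter, Finset.mem_Ioo]
  constructor
  · rintro ⟨⟨h0, h1⟩, h2, h3, h4⟩
    exact ⟨h0, h3, h4⟩
  · rintro ⟨h0, h1, h2⟩
    exact ⟨⟨h0, h1⟩, by omega, h1, h2⟩

theorem dCount_eq (I : Finset ℕ) (n : ℕ) :
    dCount I n = (Finset.univ.filter fun π : Equiv.Perm (Fin n) => descSet n π = I).card := by
  unfold dCount
  rw [Nat.card_eq_fintype_card, Fintype.card_subtype]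

/-- Glue two permutations along a subset. -/
noncomputable def glue {k l : ℕ} (S : Finset (Fin (k + l))) (hS : S.card = k) (hS' : Sᶜ.card = l)
    (σ : Equiv.Perm (Fin k)) (τ : Equiv.Perm (Fin l)) : Equiv.Perm (Fin (k + l)) :=
  finSumFinEquiv.symm.trans ((Equiv.sumCongr σ τ).trans (finSumEquivOfFinset hS hS'))

section
variable {k l : ℕ} (S : Finset (Fin (k + l))) (hS : S.card = k) (hS' : Sᶜ.card = l)
    (σ : Equiv.Perm (Fin k)) (τ : Equiv.Perm (Fin l))

theorem glue_left (i : Fin k) :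
    glue S hS hS' σ τ (Fin.castAdd l i) = S.orderEmbOfFin hS (σ i) := by
  simp [glue]

theorem glue_right (i : Fin l) :
    glue S hS hS' σ τ (Fin.natAdd k i) = Sᶜ.orderEmbOfFin hS' (τ i) := by
  simp [glue]

theorem glue_left' (i : ℕ) (h : i < k) (h' : i < k + l) :
    glue S hS hS' σ τ ⟨i, h'⟩ = S.orderEmbOfFin hS (σ ⟨i, h⟩) :=
  glue_left S hS hS' σ τ ⟨i, h⟩

theorem glue_right' (i : ℕ) (h : i < l) (h' : k + i < k + l) :
    glue S hS hS' σ τ ⟨k + i, h'⟩ = Sᶜ.orderEmbOfFin hS' (τ ⟨i, h⟩) :=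
  glue_right S hS hS' σ τ ⟨i, h⟩

theorem glue_desc_lt {i : ℕ} (hi : i < k) :
    i ∈ descSet (k + l) (glue S hS hS' σ τ) ↔ i ∈ descSet k σ := by
  rw [mem_descSet', mem_descSet']
  refine and_congr_right fun h0 => ?_
  have h1 : i < k + l := by omega
  simp only [h1, hi, exists_true_left]
  rw [glue_left' S hS hS' σ τ i hi, glue_left' S hS hS' σ τ (i - 1) (by omega)]
  simp

theorem glue_desc_gt {i : ℕ} (hi : 0 < i) :
    k + i ∈ descSet (k + l) (glue S hS hS' σ τ) ↔ i ∈ descSet l τ := by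
  rw [mem_descSet', mem_descSet']
  constructor
  · rintro ⟨_, h1, h2⟩
    refine ⟨hi, by omega, ?_⟩
    have e : (⟨k + i - 1, by omega⟩ : Fin (k + l)) = ⟨k + (i - 1), by omega⟩ := by
      ext; simp; omega
    rw [e, glue_right' S hS hS' σ τ i (by omega),
      glue_right' S hS hS' σ τ (i - 1) (by omega)] at h2
    simpa using h2
  · rintro ⟨_, h1, h2⟩
    refine ⟨by omega, by omega, ?_⟩
    have e : (⟨k + i - 1, by omega⟩ : Fin (k + l)) = ⟨k + (i - 1), by omega⟩ := by
      ext; simp; omega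
    rw [e, glue_right' S hS hS' σ τ i (by omega),
      glue_right' S hS hS' σ τ (i - 1) (by omega)]
    simpa using h2

theorem glue_desc_eq (hk : 0 < k) (hl : 0 < l) :
    k ∈ descSet (k + l) (glue S hS hS' σ τ) ↔
      Sᶜ.orderEmbOfFin hS' (τ ⟨0, hl⟩) < S.orderEmbOfFin hS (σ ⟨k - 1, by omega⟩) := by
  rw [mem_descSet']
  have h1 : k < k + l := by omega
  simp only [h1, hk, exists_true_left, true_and]
  rw [glue_left' S hS hS' σ τ (k - 1) (by omega)]
  have := glue_right' S hS hS' σ τ 0 hl (by omega)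
  simp only [Nat.add_zero] at this
  rw [this]

end

theorem glue_mem {k l : ℕ} (S : Finset (Fin (k + l))) (hS : S.card = k) (hS' : Sᶜ.card = l)
    (σ : Equiv.Perm (Fin k)) (τ : Equiv.Perm (Fin l)) (x : Fin (k + l)) :
    x ∈ S ↔ ∃ i : Fin k, glue S hS hS' σ τ (Fin.castAdd l i) = x := by
  constructor
  · intro hx
    have : x ∈ Set.range (S.orderEmbOfFin hS) := by simpa using hx
    obtain ⟨j, hj⟩ := this
    exact ⟨σ.symm j, by rw [glue_left]; simpa using hj⟩
  · rintro ⟨i, rfl⟩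
    rw [glue_left]
    exact S.orderEmbOfFin_mem hS _

theorem glue_inj {k l : ℕ} (S S' : Finset (Fin (k + l))) (hS : S.card = k) (hS' : Sᶜ.card = l)
    (h1 : S'.card = k) (h2 : S'ᶜ.card = l)
    (σ σ' : Equiv.Perm (Fin k)) (τ τ' : Equiv.Perm (Fin l))
    (h : glue S hS hS' σ τ = glue S' h1 h2 σ' τ') : S = S' ∧ σ = σ' := by
  have e : S = S' := by
    ext x
    rw [glue_mem S hS hS' σ τ, glue_mem S' h1 h2 σ' τ', h]
  subst e
  refine ⟨rfl, ?_⟩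
  ext i
  have := congrArg (fun f => f (Fin.castAdd l i)) h
  simp only [glue_left] at this
  exact congrArg Fin.val ((S.orderEmbOfFin hS).injective this)

theorem descSet_sub {n : ℕ} (π : Equiv.Perm (Fin n)) : descSet n π ⊆ Finset.Ioo 0 n := by
  intro i hi
  obtain ⟨h0, h1, _⟩ := mem_descSet'.1 hi
  simp [h0, h1]

theorem descSet_one (n : ℕ) : descSet n 1 = ∅ := by
  ext i
  rw [mem_descSet']
  simp only [Equiv.Perm.coe_one, id, Fin.mk_lt_mk, Finset.notMem_empty, iff_false]
  rintro ⟨h0, h1, h2⟩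
  omega

theorem descSet_rev (n : ℕ) : descSet n Fin.revPerm = Finset.Ioo 0 n := by
  ext i
  rw [mem_descSet']
  simp only [Fin.revPerm_apply, Fin.rev_lt_rev, Fin.mk_lt_mk, Finset.mem_Ioo]
  constructor
  · rintro ⟨h0, h1, h2⟩
    exact ⟨h0, h1⟩
  · rintro ⟨h0, h1⟩
    exact ⟨h0, h1, by omega⟩

theorem strictMono_of_nodesc {k l : ℕ} (π : Equiv.Perm (Fin (k + l)))
    (h : ∀ i, k < i → i ∉ descSet (k + l) π) : StrictMono fun i : Fin l => π (Fin.natAdd k i) := by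
  rcases l with _ | l
  · intro a; exact a.elim0
  rw [Fin.strictMono_iff_lt_succ]
  intro i
  have := h (k + (i + 1)) (by omega)
  rw [mem_descSet'] at this
  push Not at this
  have := this (by omega) (by omega)
  refine lt_of_le_of_ne (α := Fin _) ?_ ?_
  · convert this using 2 <;> (ext; simp; try omega)
  · intro e
    have := π.injective e
    simp [Fin.ext_iff] at this

theorem exists_glue {k l : ℕ} (π : Equiv.Perm (Fin (k + l)))
    (h : ∀ i, k < i → i ∉ descSet (k + l) π) :
    ∃ S hS hS' σ, π = glue S hS hS' σ 1 := by
  classical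
  let S : Finset (Fin (k + l)) := Finset.univ.image fun i : Fin k => π (Fin.castAdd l i)
  have hinj : Function.Injective fun i : Fin k => π (Fin.castAdd l i) :=
    π.injective.comp (Fin.castAdd_injective k l)
  have hS : S.card = k := by
    rw [Finset.card_image_of_injective _ hinj]; simp
  have hS' : Sᶜ.card = l := by
    rw [Finset.card_compl, hS]; simp
  have hmem : ∀ i : Fin k, π (Fin.castAdd l i) ∈ S := fun i =>
    Finset.mem_image_of_mem _ (Finset.mem_univ _)
  let f : Fin k → Fin k := fun i => (S.orderIsoOfFin hS).symm ⟨π (Fin.castAdd l i), hmem i⟩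
  have hf : Function.Injective f := by
    intro a b hab
    have := (S.orderIsoOfFin hS).symm.injective hab
    exact hinj (congrArg Subtype.val this)
  let σ : Equiv.Perm (Fin k) := Equiv.ofBijective f (Finite.injective_iff_bijective.1 hf)
  refine ⟨S, hS, hS', σ, ?_⟩
  ext x
  congr 1
  refine Fin.addCases (fun i => ?_) (fun i => ?_) x
  · rw [glue_left]
    rw [← Finset.coe_orderIsoOfFin_apply]
    simp [σ, f]
  · rw [glue_right]
    have := Finset.orderEmbOfFin_unique hS' (f := fun i : Fin l => π (Fin.natAdd k i)) (by
      intro j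
      simp only [S, Finset.mem_compl, Finset.mem_image, Finset.mem_univ, true_and, not_exists]
      intro i e
      have := π.injective e
      simp [Fin.ext_iff] at this
      omega) (strictMono_of_nodesc π h)
    exact congrFun this i

theorem dCount_rec (k l : ℕ) (J : Finset ℕ) (hJ : J ⊆ Finset.Ioo 0 k) :
    dCount (insert k J) (k + l) + dCount J (k + l) = (k + l).choose k * dCount J k := by
  classical
  have hkJ : k ∉ J := fun h => by simpa using hJ h
  have hlt : ∀ i ∈ J, i < k := fun i hi => (Finset.mem_Ioo.1 (hJ hi)).2
  have e : (k + l).choose k = (Finset.powersetCard k (Finset.univ : Finset (Fin (k + l)))).card := by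
    simp
  rw [dCount_eq, dCount_eq, dCount_eq, e, ← Finset.card_product, ← Finset.card_union_of_disjoint]
  · symm
    refine Finset.card_bij (fun a ha => glue a.1 (by simp at ha; exact ha.1)
      (by simp at ha; rw [Finset.card_compl, ha.1]; simp) a.2 1) ?_ ?_ ?_
    · rintro ⟨S, σ⟩ ha
      simp only [Finset.mem_product, Finset.mem_powersetCard, Finset.subset_univ, true_and,
        Finset.mem_filter, Finset.mem_univ] at ha
      obtain ⟨hS, hσ⟩ := ha
      have hS' : Sᶜ.card = l := by rw [Finset.card_compl, hS]; simp
      have key : ∀ i, i ≠ k → (i ∈ descSet (k + l) (glue S hS hS' σ 1) ↔ i ∈ J) := by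
        intro i hi
        rcases lt_or_gt_of_ne hi with h | h
        · rw [glue_desc_lt _ _ _ _ _ h, hσ]
        · obtain ⟨j, rfl⟩ := Nat.exists_eq_add_of_lt h
          rw [add_assoc, glue_desc_gt _ _ _ _ _ (by omega), descSet_one]
          simp only [Finset.notMem_empty, false_iff]
          intro h'
          have := hlt _ h'
          omega
      simp only [Finset.mem_union, Finset.mem_filter, Finset.mem_univ, true_and]
      by_cases hk' : k ∈ descSet (k + l) (glue S hS hS' σ 1)
      · left
        ext i
        by_cases h : i = k
        · subst h; simp [hk']
        · rw [key i h]; simp [h]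
      · right
        ext i
        by_cases h : i = k
        · subst h; simp [hk', hkJ]
        · rw [key i h]
    · rintro ⟨S, σ⟩ ha ⟨S', σ'⟩ hb hab
      obtain ⟨h1, h2⟩ := glue_inj _ _ _ _ _ _ _ _ _ _ hab
      simp at h1 h2
      rw [h1, h2]
    · intro π hπ
      simp only [Finset.mem_union, Finset.mem_filter, Finset.mem_univ, true_and] at hπ
      have hno : ∀ i, k < i → i ∉ descSet (k + l) π := by
        intro i hi hmem
        have : i ∈ J := by
          rcases hπ with h | h
          · rw [h] at hmem
            rcases Finset.mem_insert.1 hmem with h | h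
            · omega
            · exact h
          · rwa [h] at hmem
        have := hlt _ this
        omega
      obtain ⟨S, hS, hS', σ, rfl⟩ := exists_glue π hno
      refine ⟨(S, σ), ?_, rfl⟩
      simp only [Finset.mem_product, Finset.mem_powersetCard, Finset.subset_univ, true_and,
        Finset.mem_filter, Finset.mem_univ]
      refine ⟨hS, ?_⟩
      ext i
      rcases lt_or_ge i k with h | h
      · rw [← glue_desc_lt S hS hS' σ 1 h]
        rcases hπ with h' | h'
        · rw [h']; simp [h.ne]
        · rw [h']
      · constructor
        · intro h'
          have := (Finset.mem_Ioo.1 (descSet_sub _ h')).2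
          omega
        · intro h'
          have := hlt _ h'
          omega
  · rw [Finset.disjoint_left]
    intro π h1 h2
    simp only [Finset.mem_filter, Finset.mem_univ, true_and] at h1 h2
    rw [h1] at h2
    exact hkJ (h2 ▸ Finset.mem_insert_self k J)

theorem exists_perm (k : ℕ) : ∀ J ⊆ Finset.Ioo 0 k, ∃ σ : Equiv.Perm (Fin k), descSet k σ = J := by
  classical
  induction k with
  | zero =>
    intro J hJ
    refine ⟨1, ?_⟩
    rw [descSet_one]
    exact (Finset.subset_empty.1 (by simpa using hJ)).symm
  | succ k ih =>
    intro J hJ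
    obtain ⟨σ, hσ⟩ := ih (J.erase k) (by
      intro i hi
      rw [Finset.mem_erase] at hi
      have := Finset.mem_Ioo.1 (hJ hi.2)
      rw [Finset.mem_Ioo]; omega)
    rcases Nat.eq_zero_or_pos k with rfl | hk
    · refine ⟨1, ?_⟩
      rw [descSet_one]
      symm
      rw [← Finset.subset_empty]
      intro i hi
      have := Finset.mem_Ioo.1 (hJ hi)
      omega
    have main : ∀ a : Fin (k + 1), (∀ S : Finset (Fin (k + 1)), S = {a}ᶜ →
        ∀ b ∈ S, (a < b ↔ k ∈ J)) → ∃ σ : Equiv.Perm (Fin (k + 1)), descSet (k + 1) σ = J := by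
      intro a ha
      have hS : ({a}ᶜ : Finset (Fin (k + 1))).card = k := by
        rw [Finset.card_compl]; simp
      have hS' : ({a}ᶜᶜ : Finset (Fin (k + 1))).card = 1 := by simp
      refine ⟨glue _ hS hS' σ 1, ?_⟩
      ext i
      rcases lt_trichotomy i k with h | rfl | h
      · rw [glue_desc_lt _ _ _ _ _ h, hσ]; simp [h.ne]
      · rw [glue_desc_eq _ _ _ _ _ hk one_pos]
        have h1 := Finset.orderEmbOfFin_mem ({a}ᶜᶜ) hS' ((1 : Equiv.Perm (Fin 1)) ⟨0, one_pos⟩)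
        rw [Finset.mem_compl, Finset.mem_compl, not_not, Finset.mem_singleton] at h1
        rw [h1]
        exact ha _ rfl _ (Finset.orderEmbOfFin_mem _ _ _)
      · constructor
        · intro h'
          have := (Finset.mem_Ioo.1 (descSet_sub _ h')).2
          omega
        · intro h'
          have := (Finset.mem_Ioo.1 (hJ h')).2
          omega
    by_cases hkJ : k ∈ J
    · refine main 0 ?_
      rintro S rfl b hb
      simp only [hkJ, iff_true]
      simp at hb
      exact Fin.pos_iff_ne_zero.2 hb
    · refine main (Fin.last k) ?_
      rintro S rfl b hb
      simp only [hkJ, iff_false, not_lt]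
      exact Fin.le_last b

theorem dCount_lower (k s : ℕ) (J : Finset ℕ) (hJ : J ⊆ Finset.Ioo 0 k) :
    (k + s).choose k ≤ dCount (J ∪ Finset.Ico (k + 1) (k + 1 + s)) (k + 1 + s) := by
  classical
  obtain ⟨σ, hσ⟩ := exists_perm k J hJ
  have hlt : ∀ i ∈ J, 0 < i ∧ i < k := fun i hi => Finset.mem_Ioo.1 (hJ hi)
  have e0 : k + 1 + s = k + (s + 1) := by ring
  rw [e0]
  have e : (k + s).choose k =
      (Finset.powersetCard k ((Finset.univ : Finset (Fin (k + (s + 1)))).erase (Fin.last (k + s)))).card := by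
    rw [Finset.card_powersetCard, Finset.card_erase_of_mem (Finset.mem_univ _)]; simp
  rw [e, dCount_eq, ← Finset.card_attach]
  have hc : ∀ S ∈ Finset.powersetCard k ((Finset.univ : Finset (Fin (k + (s + 1)))).erase (Fin.last (k + s))),
      S.card = k ∧ Sᶜ.card = s + 1 ∧ Fin.last (k + s) ∉ S := by
    intro S hS
    rw [Finset.mem_powersetCard] at hS
    refine ⟨hS.2, by rw [Finset.card_compl, hS.2]; simp, fun h => ?_⟩
    simpa using hS.1 h
  refine Finset.card_le_card_of_injOn
    (fun a => glue a.1 (hc _ a.2).1 (hc _ a.2).2.1 σ Fin.revPerm) ?_ ?_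
  · rintro ⟨S, hS⟩ -
    obtain ⟨h1, h2, h3⟩ := hc S hS
    simp only [Finset.coe_filter, Finset.mem_univ, true_and, Set.mem_ofPred_eq]
    ext i
    simp only [Finset.mem_union, Finset.mem_Ico]
    rcases lt_trichotomy i k with h | rfl | h
    · rw [glue_desc_lt _ _ _ _ _ h, hσ]
      constructor
      · intro h; exact Or.inl h
      · rintro (h | h)
        · exact h
        · omega
    · have : ¬ (i ∈ J ∨ i + 1 ≤ i ∧ i < i + (s + 1)) := by
        rintro (h | h)
        · have := hlt _ h; omega
        · omega
      simp only [this, iff_false]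
      rcases Nat.eq_zero_or_pos i with rfl | hi
      · intro h
        have := (Finset.mem_Ioo.1 (descSet_sub _ h)).1
        omega
      · rw [glue_desc_eq _ _ _ _ _ hi (Nat.succ_pos s), not_lt]
        have hm : Fin.last (i + s) ∈ Sᶜ := by simpa using h3
        have : Fin.last (i + s) ∈ Set.range (Sᶜ.orderEmbOfFin h2) := by simpa using hm
        obtain ⟨j, hj⟩ := this
        refine le_trans (Fin.le_last _) ?_
        refine le_trans (le_of_eq hj.symm) ?_
        rw [OrderEmbedding.le_iff_le]
        simp only [Fin.revPerm_apply, Fin.le_def, Fin.val_rev]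
        omega
    · obtain ⟨j, rfl⟩ := Nat.exists_eq_add_of_lt h
      rw [add_assoc k j 1, glue_desc_gt _ _ _ _ _ (by omega), descSet_rev, Finset.mem_Ioo]
      constructor
      · intro h'
        right; omega
      · rintro (h' | h')
        · have := hlt _ h'; omega
        · omega
  · rintro ⟨S, hS⟩ - ⟨S', hS'⟩ - hab
    have := (glue_inj _ _ _ _ _ _ _ _ _ _ hab).1
    exact Subtype.ext this

open Polynomial in
/-- The binomial polynomial `X choose k`. -/
noncomputable def binP (k : ℕ) : ℝ[X] := C ((k.factorial : ℝ)⁻¹) * descPochhammer ℝ k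

theorem binP_natDegree (k : ℕ) : (binP k).natDegree ≤ k :=
  (Polynomial.natDegree_C_mul_le _ _).trans (descPochhammer_natDegree ℝ k).le

theorem binP_eval_nat (k n : ℕ) : (binP k).eval (n : ℝ) = n.choose k := by
  simp only [binP, Polynomial.eval_mul, Polynomial.eval_C]
  rw [descPochhammer_eval_eq_descFactorial, Nat.descFactorial_eq_factorial_mul_choose]
  push_cast
  field_simp

theorem binP_eval_succ (k : ℕ) (x : ℝ) :
    (binP (k + 1)).eval x = (x - k) / (k + 1) * (binP k).eval x := by
  simp only [binP, Polynomial.eval_mul, Polynomial.eval_C]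
  rw [descPochhammer_succ_eval, Nat.factorial_succ]
  push_cast
  have : (k.factorial : ℝ) ≠ 0 := by positivity
  field_simp

theorem binP_pos (j r : ℕ) (h : r ≤ j) : 0 < (binP r).eval ((j : ℝ) - 1 / 2) := by
  induction r with
  | zero => simp [binP]
  | succ r ih =>
    rw [binP_eval_succ]
    have h1 : (r : ℝ) + 1 ≤ j := by exact_mod_cast h
    have := ih (by omega)
    have : 0 < (j : ℝ) - 1 / 2 - r := by linarith
    positivity

theorem binP_sign (j r : ℕ) (h : j ≤ r) :
    0 < (-1 : ℝ) ^ (r + j) * (binP r).eval ((j : ℝ) - 1 / 2) := by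
  induction r, h using Nat.le_induction with
  | base =>
    have := binP_pos j j le_rfl
    rw [← two_mul, pow_mul]
    simpa using this
  | succ r hr ih =>
    rw [binP_eval_succ]
    have h1 : (j : ℝ) ≤ r := by exact_mod_cast hr
    have h2 : 0 < (r - ((j : ℝ) - 1 / 2)) / (r + 1) := div_pos (by linarith) (by positivity)
    have := mul_pos h2 ih
    refine this.trans_eq ?_
    rw [show r + 1 + j = r + j + 1 by ring, pow_succ]
    ring

theorem w_bound (k j : ℕ) (hj : j ≤ k) (s : ℕ) :
    (-1 : ℝ) ^ (k + 1 + j) * (binP (k + 1)).eval ((j : ℝ) - 1 / 2) ≤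
      ((k + s).choose k : ℝ) * ((-1 : ℝ) ^ (k + 1 + s + j) *
        (binP (k + 1 + s)).eval ((j : ℝ) - 1 / 2)) * (s + 1) := by
  induction s with
  | zero => simp
  | succ s ih =>
    refine ih.trans ?_
    have hb := binP_sign j (k + 1 + s) (by omega)
    set b := (-1 : ℝ) ^ (k + 1 + s + j) * (binP (k + 1 + s)).eval ((j : ℝ) - 1 / 2) with hbdef
    have e1 : (-1 : ℝ) ^ (k + 1 + (s + 1) + j) * (binP (k + 1 + (s + 1))).eval ((j : ℝ) - 1 / 2)
        = ((k + 1 + s : ℝ) - (j - 1 / 2)) / (k + 1 + s + 1) * b := by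
      rw [← add_assoc (k + 1) s 1, binP_eval_succ, hbdef,
        show k + 1 + s + 1 + j = k + 1 + s + j + 1 by ring, pow_succ]
      push_cast
      ring
    have e2 : ((k + (s + 1)).choose k : ℝ) = (k + s).choose k * (k + s + 1) / (s + 1) := by
      have := Nat.choose_mul_succ_eq (k + s) k
      rw [show k + s + 1 - k = s + 1 by omega] at this
      rw [eq_div_iff (by positivity)]
      exact_mod_cast this.symm
    rw [e1, e2]
    have hC : (0 : ℝ) ≤ (k + s).choose k := by positivity
    have hj' : (j : ℝ) ≤ k := by exact_mod_cast hj
    have hk0 : (0 : ℝ) ≤ k := by positivity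
    have hs0 : (0 : ℝ) ≤ s := by positivity
    have key : (s + 1 : ℝ) ≤ (k + s + 1) / (s + 1) *
        (((k + 1 + s : ℝ) - (j - 1 / 2)) / (k + 1 + s + 1)) * (s + 1 + 1) := by
      rw [div_mul_div_comm, div_mul_eq_mul_div, le_div_iff₀ (by positivity)]
      have h1 : (s + 3 / 2 : ℝ) ≤ (k + 1 + s : ℝ) - (j - 1 / 2) := by linarith
      have h2 : (k + s + 1 : ℝ) * (s + 3 / 2) * (s + 1 + 1) ≤
          (k + s + 1) * ((k + 1 + s : ℝ) - (j - 1 / 2)) * (s + 1 + 1) := by gcongr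
      refine le_trans ?_ h2
      nlinarith [mul_nonneg hk0 hs0, mul_nonneg hs0 hs0]
    have := mul_le_mul_of_nonneg_left key (mul_nonneg hC hb.le)
    push_cast
    refine this.trans (le_of_eq ?_)
    ring

theorem sum_diverges (k j : ℕ) (hj : j ≤ k) (c : ℕ → ℝ)
    (hc : ∀ s, ((k + s).choose k : ℝ) ≤ c s) (B : ℝ) :
    ∃ t₀, ∀ t, t₀ ≤ t → B < ∑ s ∈ Finset.range t, c s * ((-1 : ℝ) ^ (k + 1 + s + j) *
        (binP (k + 1 + s)).eval ((j : ℝ) - 1 / 2)) := by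
  set w := (-1 : ℝ) ^ (k + 1 + j) * (binP (k + 1)).eval ((j : ℝ) - 1 / 2) with hw
  have hw0 : 0 < w := binP_sign j (k + 1) (by omega)
  obtain ⟨t₀, ht₀⟩ := Filter.eventually_atTop.1
    (Real.tendsto_sum_range_one_div_nat_succ_atTop.eventually_gt_atTop (B / w))
  refine ⟨t₀, fun t ht => ?_⟩
  have h1 := ht₀ t ht
  rw [div_lt_iff₀ hw0, Finset.sum_mul] at h1
  refine h1.trans_le (Finset.sum_le_sum fun s _ => ?_)
  have hb := binP_sign j (k + 1 + s) (by omega)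
  have h2 := w_bound k j hj s
  have h3 := mul_le_mul_of_nonneg_right (hc s) hb.le
  refine le_trans ?_ h3
  rw [one_div, inv_mul_le_iff₀ (by positivity), mul_comm]
  exact h2

open Polynomial in
/-- The recursively defined polynomials. -/
noncomputable def PP (q : ℝ[X]) (c : ℕ → ℝ) (m : ℕ) : ℕ → ℝ[X]
  | 0 => q
  | t + 1 => C (c t) * binP (m + t) - PP q c m t

open Polynomial in
theorem PP_natDegree (q : ℝ[X]) (c : ℕ → ℝ) (k : ℕ) (hq : q.natDegree ≤ k) (t : ℕ) :
    (PP q c (k + 1) t).natDegree ≤ k + t := by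
  induction t with
  | zero => exact hq
  | succ t ih =>
    rw [PP]
    refine (natDegree_sub_le _ _).trans (max_le ?_ (by omega))
    refine (natDegree_C_mul_le _ _).trans ((binP_natDegree _).trans (by omega))

open Polynomial in
theorem PP_sum (q : ℝ[X]) (c : ℕ → ℝ) (m : ℕ) (x : ℝ) (t : ℕ) :
    (-1 : ℝ) ^ t * (PP q c m t).eval x =
      q.eval x - ∑ s ∈ Finset.range t, (-1 : ℝ) ^ s * c s * (binP (m + s)).eval x := by
  induction t with
  | zero => simp [PP]
  | succ t ih =>
    rw [PP, Finset.sum_range_succ, ← sub_sub, ← ih, pow_succ]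
    simp only [eval_sub, eval_mul, eval_C]
    ring

open Polynomial in
theorem PP_count (J : Finset ℕ) (m : ℕ) (hm : 0 < m) (hJ : J ⊆ Finset.Ioo 0 m) (q : ℝ[X])
    (hq : ∀ n : ℕ, m ≤ n → q.eval (n : ℝ) = dCount J n) (t n : ℕ) (hn : m + t ≤ n) :
    (PP q (fun s => dCount (J ∪ Finset.Ico m (m + s)) (m + s)) m t).eval (n : ℝ) =
      dCount (J ∪ Finset.Ico m (m + t)) n := by
  induction t generalizing n with
  | zero => simpa [PP] using hq n (by omega)
  | succ t ih =>
    rw [PP]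
    simp only [eval_sub, eval_mul, eval_C]
    rw [ih n (by omega), binP_eval_nat]
    have e : J ∪ Finset.Ico m (m + (t + 1)) = insert (m + t) (J ∪ Finset.Ico m (m + t)) := by
      ext i
      simp only [Finset.mem_union, Finset.mem_Ico, Finset.mem_insert]
      constructor
      · rintro (h | h)
        · exact Or.inr (Or.inl h)
        · by_cases h' : i = m + t
          · exact Or.inl h'
          · right; right; omega
      · rintro (h | h | h)
        · right; omega
        · exact Or.inl h
        · right; omega
    rw [e]
    obtain ⟨l, rfl⟩ := Nat.exists_eq_add_of_le (show m + t ≤ n by omega)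
    have := dCount_rec (m + t) l (J ∪ Finset.Ico m (m + t)) (by
      intro i hi
      rw [Finset.mem_Ioo]
      rcases Finset.mem_union.1 hi with h | h
      · have := Finset.mem_Ioo.1 (hJ h); omega
      · have := Finset.mem_Ico.1 h; omega)
    have := congrArg (Nat.cast : ℕ → ℝ) this
    push_cast at this ⊢
    linarith

open Polynomial in
theorem PP_root (J : Finset ℕ) (m : ℕ) (hm : 0 < m) (hJ : J ⊆ Finset.Ioo 0 m) (q : ℝ[X])
    (hq : ∀ n : ℕ, m ≤ n → q.eval (n : ℝ) = dCount J n) (t s : ℕ) (hs : s < t) :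
    (PP q (fun s => dCount (J ∪ Finset.Ico m (m + s)) (m + s)) m t).eval ((m + s : ℕ) : ℝ) = 0 := by
  induction t with
  | zero => omega
  | succ t ih =>
    rw [PP]
    simp only [eval_sub, eval_mul, eval_C]
    rw [binP_eval_nat]
    rcases Nat.lt_succ_iff_lt_or_eq.1 hs with h | rfl
    · rw [ih h, Nat.choose_eq_zero_of_lt (by omega)]
      simp
    · rw [PP_count J m hm hJ q hq s _ le_rfl]
      simp

theorem dCount_empty (n : ℕ) : dCount ∅ n = 1 := by
  have := dCount_rec 0 n ∅ (by simp)
  have h0 : dCount (insert 0 ∅) (0 + n) = 0 := by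
    rw [dCount_eq, Finset.card_eq_zero, Finset.filter_eq_empty_iff]
    intro π _ h
    have h1 : 0 ∈ descSet (0 + n) π := by rw [h]; simp
    have := (Finset.mem_Ioo.1 (descSet_sub _ h1)).1
    omega
  have h1 : dCount ∅ 0 = 1 := by
    rw [dCount_eq, Finset.card_eq_one]
    refine ⟨1, ?_⟩
    ext π
    simp only [Finset.mem_filter, Finset.mem_univ, true_and, Finset.mem_singleton]
    have : π = 1 := Subsingleton.elim _ _
    simp [this, descSet_one]
  rw [h0, h1] at this
  simpa using this

open Polynomial in
theorem exists_poly (N : ℕ) : ∀ J ⊆ Finset.Ioo 0 (N + 1), ∃ q : ℝ[X], q.natDegree ≤ N ∧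
    ∀ n : ℕ, N + 1 ≤ n → q.eval (n : ℝ) = dCount J n := by
  induction N with
  | zero =>
    intro J hJ
    have : J = ∅ := by
      rw [← Finset.subset_empty]
      intro i hi
      have := Finset.mem_Ioo.1 (hJ hi)
      omega
    subst this
    exact ⟨1, by simp, fun n _ => by simp [dCount_empty]⟩
  | succ N ih =>
    intro J hJ
    have hJ' : J.erase (N + 1) ⊆ Finset.Ioo 0 (N + 1) := by
      intro i hi
      rw [Finset.mem_erase] at hi
      have := Finset.mem_Ioo.1 (hJ hi.2)
      rw [Finset.mem_Ioo]; omega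
    obtain ⟨q, hq, hq'⟩ := ih _ hJ'
    by_cases h : N + 1 ∈ J
    · refine ⟨PP q (fun s => dCount (J.erase (N + 1) ∪ Finset.Ico (N + 1) (N + 1 + s)) (N + 1 + s))
        (N + 1) 1, PP_natDegree q _ N hq 1, fun n hn => ?_⟩
      rw [PP_count _ _ (by omega) hJ' q hq' 1 n hn]
      congr 2
      ext i
      simp only [Finset.mem_union, Finset.mem_erase, Finset.mem_Ico]
      constructor
      · rintro (h' | h')
        · exact h'.2
        · have : i = N + 1 := by omega
          rwa [this]
      · intro h'
        by_cases h'' : i = N + 1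
        · right; omega
        · exact Or.inl ⟨h'', h'⟩
    · rw [Finset.erase_eq_of_notMem h] at hq'
      exact ⟨q, by omega, fun n hn => hq' n (by omega)⟩

open Polynomial in
theorem main_aux (k : ℕ) (J : Finset ℕ) (hJ : J ⊆ Finset.Ioo 0 k) :
    ∃ t₀ : ℕ, ∀ t : ℕ, t₀ < t → ∃ Q : ℝ[X], Q ≠ 0 ∧ Q.natDegree ≤ k + 1 + t ∧
      (∀ n : ℕ, k + 1 + t < n → Q.eval (n : ℝ) =
        dCount (J ∪ Finset.Ico (k + 1) (k + 1 + (t + 1))) n) ∧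
      ∃ r : ℕ → ℝ, (∀ i < k + 1 + t, Q.eval (r i) = 0 ∧ -1 ≤ r i ∧ r i ≤ k + 1 + t) ∧
        ∀ i j, i < j → r i < r j := by
  have hJ1 : J ⊆ Finset.Ioo 0 (k + 1) := by
    intro i hi
    have := Finset.mem_Ioo.1 (hJ hi)
    rw [Finset.mem_Ioo]; omega
  obtain ⟨q, hqd, hq⟩ := exists_poly k J hJ1
  set c : ℕ → ℝ := fun s => dCount (J ∪ Finset.Ico (k + 1) (k + 1 + s)) (k + 1 + s) with hcdef
  have hc : ∀ s, ((k + s).choose k : ℝ) ≤ c s := fun s => by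
    simp only [hcdef]
    exact_mod_cast dCount_lower k s J hJ
  have hdiv : ∀ j : ℕ, ∃ t₀, j ≤ k → ∀ t, t₀ ≤ t →
      (-1 : ℝ) ^ (k + 1 + j) * ((-1 : ℝ) ^ t * (PP q c (k + 1) t).eval ((j : ℝ) - 1 / 2)) < 0 := by
    intro j
    by_cases hj : j ≤ k
    · obtain ⟨t₀, h⟩ := sum_diverges k j hj c hc
        ((-1 : ℝ) ^ (k + 1 + j) * q.eval ((j : ℝ) - 1 / 2))
      refine ⟨t₀, fun _ t ht => ?_⟩
      have := h t ht
      rw [PP_sum, mul_sub, sub_neg]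
      refine this.trans_le (le_of_eq ?_)
      rw [Finset.mul_sum]
      refine Finset.sum_congr rfl fun s _ => ?_
      rw [show k + 1 + s + j = k + 1 + j + s by ring, pow_add]
      ring
    · exact ⟨0, fun h => absurd h hj⟩
  choose T hT using hdiv
  refine ⟨(Finset.range (k + 1)).sup T, fun t ht => ?_⟩
  have hsgn : ∀ j ≤ k, (-1 : ℝ) ^ (k + 1 + j) * ((-1 : ℝ) ^ (t + 1) *
      (PP q c (k + 1) (t + 1)).eval ((j : ℝ) - 1 / 2)) < 0 := by
    intro j hj
    refine hT j hj (t + 1) ?_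
    have := Finset.le_sup (f := T) (show j ∈ Finset.range (k + 1) from Finset.mem_range.2 (by omega))
    omega
  set Q := PP q c (k + 1) (t + 1) with hQ
  have hroot : ∀ i : ℕ, ∃ x : ℝ, i < k → ((i : ℝ) - 1 / 2 < x ∧ x < i + 1 / 2 ∧ Q.eval x = 0) := by
    intro i
    by_cases hi : i < k
    · have h1 := hsgn i hi.le
      have h2 := hsgn (i + 1) hi
      set F : ℝ → ℝ := fun x => (-1 : ℝ) ^ (k + 1 + i) * ((-1 : ℝ) ^ (t + 1) * Q.eval x) with hF
      have hcont : ContinuousOn F (Set.Icc ((i : ℝ) - 1 / 2) (((i + 1 : ℕ) : ℝ) - 1 / 2)) := by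
        apply Continuous.continuousOn
        have := Q.continuous
        fun_prop
      have ha : F ((i : ℝ) - 1 / 2) < 0 := h1
      have hb : 0 < F (((i + 1 : ℕ) : ℝ) - 1 / 2) := by
        rw [← add_assoc, pow_succ] at h2
        simp only [hF]
        linarith
      obtain ⟨x, hx, hx0⟩ := intermediate_value_Ioo (by push_cast; linarith) hcont ⟨ha, hb⟩
      refine ⟨x, fun _ => ⟨hx.1, ?_, ?_⟩⟩
      · have := hx.2
        push_cast at this
        linarith
      · simpa [hF] using hx0
    · exact ⟨0, fun h => absurd h hi⟩
  choose ρ hρ using hroot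
  refine ⟨Q, ?_, ?_, ?_, fun i => if i < k then ρ i else (i : ℝ) + 1, ?_, ?_⟩
  · intro h0
    have := hsgn 0 (Nat.zero_le _)
    rw [h0] at this
    simp at this
  · exact (PP_natDegree q c k hqd (t + 1)).trans (by omega)
  · intro n hn
    exact PP_count J (k + 1) (by omega) hJ1 q hq (t + 1) n (by omega)
  · intro i hi
    have hi' : (i : ℝ) + 1 ≤ k + 1 + t := by exact_mod_cast hi
    have hi0 : (0 : ℝ) ≤ i := by positivity
    by_cases h : i < k
    · simp only [h, if_true]
      obtain ⟨h1, h2, h3⟩ := hρ i h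
      exact ⟨h3, by linarith, by linarith⟩
    · simp only [h, if_false]
      refine ⟨?_, by linarith, by linarith⟩
      have := PP_root J (k + 1) (by omega) hJ1 q hq (t + 1) (i - k) (by omega)
      rw [show k + 1 + (i - k) = i + 1 by omega] at this
      push_cast at this
      exact this
  · intro i j hij
    have hij' : (i : ℝ) + 1 ≤ j := by exact_mod_cast hij
    by_cases hj : j < k
    · have hi : i < k := by omega
      simp only [hi, hj, if_true]
      have h1 := hρ i hi
      have h2 := hρ j hj
      linarith [h1.2.1, h2.1]
    · by_cases hi : i < k
      · simp only [hi, hj, if_true, if_false]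
        linarith [(hρ i hi).2.1]
      · simp only [hi, hj, if_false]
        linarith

/-- Let `I` be a nonempty finite set of positive integers with
`m = max I` and `m − 1 ∉ I`.  Then there exists `t₀ ∈ ℕ` such that for every `t > t₀`,
all complex roots of the descent polynomial of `I^t = I ∪ {m+1,…,m+t}` are real and lie
in the interval `[−1, m+t]`. -/
theorem stmt19 (I : Finset ℕ) (hI : I.Nonempty) (hpos : ∀ i ∈ I, 0 < i)
    (hm1 : mI I - 1 ∉ I) :
    ∃ t₀ : ℕ, ∀ t : ℕ, t₀ < t →
      ∀ p : Polynomial ℂ, p.natDegree ≤ mI I + t →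
        (∀ n : ℕ, mI I + t < n → p.eval (n : ℂ) = dCount (Iext I t) n) →
        ∀ z₀ : ℂ, p.eval z₀ = 0 →
          z₀.im = 0 ∧ -1 ≤ z₀.re ∧ z₀.re ≤ mI I + t := by
  classical
  obtain ⟨i₀, hi₀⟩ := hI
  have hmem : mI I ∈ I := by
    obtain ⟨i, hi, h⟩ := Finset.exists_mem_eq_sup I ⟨i₀, hi₀⟩ id
    unfold mI
    rw [h]
    exact hi
  have hle : ∀ i ∈ I, i ≤ mI I := fun i hi => Finset.le_sup (f := id) hi
  obtain ⟨k, hk⟩ : ∃ k, mI I = k + 1 := ⟨mI I - 1, by have := hpos _ hmem; omega⟩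
  have hJ : I.erase (k + 1) ⊆ Finset.Ioo 0 k := by
    intro i hi
    rw [Finset.mem_erase] at hi
    have h1 := hle i hi.2
    have h2 := hpos i hi.2
    have h3 : i ≠ k := by
      rintro rfl
      rw [hk] at hm1
      exact hm1 hi.2
    rw [Finset.mem_Ioo]
    omega
  obtain ⟨t₀, ht₀⟩ := main_aux k _ hJ
  refine ⟨t₀, fun t ht p hpd hp z hz => ?_⟩
  obtain ⟨Q, hQ0, hQd, hQ, r, hr, hrm⟩ := ht₀ t ht
  have hset : Iext I t = I.erase (k + 1) ∪ Finset.Ico (k + 1) (k + 1 + (t + 1)) := by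
    ext i
    simp only [Iext, hk, Finset.mem_union, Finset.mem_Icc, Finset.mem_erase, Finset.mem_Ico]
    constructor
    · rintro (h | h)
      · by_cases h' : i = k + 1
        · right; omega
        · exact Or.inl ⟨h', h⟩
      · right; omega
    · rintro (h | h)
      · exact Or.inl h.2
      · by_cases h' : i = k + 1
        · left; rw [h', ← hk]; exact hmem
        · right; omega
  have hpQ : p = Q.map Complex.ofRealHom := by
    apply Polynomial.eq_of_infinite_eval_eq
    have hinf : (Set.range fun n : ℕ => ((k + 1 + t + 1 + n : ℕ) : ℂ)).Infinite := by
      apply Set.infinite_range_of_injective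
      intro a b hab
      have := Nat.cast_injective (R := ℂ) hab
      omega
    refine hinf.mono ?_
    rintro _ ⟨n, rfl⟩
    have h1 := hp (k + 1 + t + 1 + n) (by omega)
    have h2 := hQ (k + 1 + t + 1 + n) (by omega)
    have h3 := Polynomial.eval_map_apply (f := Complex.ofRealHom) (p := Q)
      ((k + 1 + t + 1 + n : ℕ) : ℝ)
    rw [h2, ← hset] at h3
    have h4 : (Complex.ofRealHom ((k + 1 + t + 1 + n : ℕ) : ℝ)) = ((k + 1 + t + 1 + n : ℕ) : ℂ) := by
      simp
    rw [h4] at h3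
    show Polynomial.eval _ p = _
    rw [h1, h3]
    simp
  by_cases hz' : ∃ i < k + 1 + t, z = (r i : ℂ)
  · obtain ⟨i, hi, rfl⟩ := hz'
    obtain ⟨_, h1, h2⟩ := hr i hi
    refine ⟨Complex.ofReal_im _, ?_, ?_⟩
    · simpa using h1
    · rw [hk]; push_cast; simpa using h2
  · exfalso
    push Not at hz'
    have hinj : StrictMono r := fun i j h => hrm i j h
    let s : Finset ℂ := (Finset.range (k + 1 + t)).image fun i => (r i : ℂ)
    have hs : s.card = k + 1 + t := by
      exact (Finset.card_image_of_injective _ (Complex.ofReal_injective.comp hinj.injective)).trans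
        (Finset.card_range _)
    have hzs : z ∉ s := by
      intro h
      obtain ⟨i, hi, h⟩ := Finset.mem_image.1 h
      exact hz' i (Finset.mem_range.1 hi) h.symm
    have hp0 : p = 0 := by
      apply Polynomial.eq_zero_of_natDegree_lt_card_of_eval_eq_zero' p (insert z s)
      · intro x hx
        rcases Finset.mem_insert.1 hx with rfl | hx
        · exact hz
        · obtain ⟨i, hi, rfl⟩ := Finset.mem_image.1 hx
          have h3 := Polynomial.eval_map_apply (f := Complex.ofRealHom) (p := Q) (r i)
          rw [(hr i (Finset.mem_range.1 hi)).1] at h3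
          rw [hpQ]
          simpa using h3
      · rw [Finset.card_insert_of_notMem hzs, hs]
        omega
    rw [hp0] at hpQ
    exact hQ0 ((Polynomial.map_eq_zero_iff Complex.ofRealHom.injective).1 hpQ.symm)
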